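/- For every integer n ≥ 2, every T ∈ ℝ^{d×d} with T ≠ 0, and every S ∈ ℝ^{d×d}, the derivative of F_n satisfies the identity T : (DF_n(T)[S]) = [ (1 + |T|^a)^{−1−1/a} + (n + |T|^{1−1/n}) / (n²(1 + |T|^{1−1/n})²) ] · (T : S). -/

import Mathlib

open scoped RealInnerProductSpace

/-- `F(T) = (1 + |T|^a)^{-1/a} T` on `ℝ^{d×d}`, realised as the Euclidean space
`EuclideanSpace ℝ (Fin d × Fin d)` (Frobenius norm and inner product). -/
noncomputable def matF (d : ℕ) (a : ℝ) (T : EuclideanSpace ℝ (Fin d × Fin d)) :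
    EuclideanSpace ℝ (Fin d × Fin d) :=
  ((1 + ‖T‖ ^ a) ^ (-(1 / a))) • T

/-- The regularised map `F_n(T) = F(T) + T / (n (1 + |T|^{1 - 1/n}))`. -/
noncomputable def matFn (d : ℕ) (a : ℝ) (n : ℕ) (T : EuclideanSpace ℝ (Fin d × Fin d)) :
    EuclideanSpace ℝ (Fin d × Fin d) :=
  matF d a T + ((n : ℝ) * (1 + ‖T‖ ^ (1 - 1 / (n : ℝ))))⁻¹ • T

theorem hasFDerivAt_norm_of_ne_zero {E : Type*} [NormedAddCommGroup E] [InnerProductSpace ℝ E]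
    {x : E} (hx : x ≠ 0) : HasFDerivAt (fun y : E => ‖y‖) (‖x‖⁻¹ • innerSL ℝ x) x := by
  have h := (hasStrictFDerivAt_norm_sq x).hasFDerivAt.sqrt (by simpa using hx)
  simp only [Real.sqrt_sq (norm_nonneg _)] at h
  convert h using 1
  ext y
  simp
  field_simp

/-- The radial part of the derivative of the radial map `x ↦ φ(‖x‖) x`. -/
theorem inner_fderiv_radial {E : Type*} [NormedAddCommGroup E] [InnerProductSpace ℝ E]
    {φ : ℝ → ℝ} {φ' : ℝ} {x : E} (hx : x ≠ 0) (hφ : HasDerivAt φ φ' ‖x‖) (v : E) :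
    DifferentiableAt ℝ (fun y : E => φ ‖y‖ • y) x ∧
      ⟪x, fderiv ℝ (fun y : E => φ ‖y‖ • y) x v⟫ = (φ ‖x‖ + ‖x‖ * φ') * ⟪x, v⟫ := by
  have h := (hφ.comp_hasFDerivAt x (hasFDerivAt_norm_of_ne_zero hx)).smul (hasFDerivAt_id x)
  refine ⟨h.differentiableAt, ?_⟩
  have hx' : ‖x‖ ≠ 0 := norm_ne_zero_iff.mpr hx
  rw [show fderiv ℝ (fun y : E => φ ‖y‖ • y) x = _ from h.fderiv]
  simp [inner_add_right, inner_smul_right]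
  field_simp

/-- For every integer `n ≥ 2`, every `T ≠ 0` and every `S`,
`T : (DF_n(T)[S]) = [ (1+|T|^a)^{−1−1/a} + (n+|T|^{1−1/n})/(n²(1+|T|^{1−1/n})²) ] (T : S)`. -/
theorem stmt_10 {d : ℕ} (hd : 1 ≤ d) {a : ℝ} (ha : 0 < a) (n : ℕ) (hn : 2 ≤ n)
    (T : EuclideanSpace ℝ (Fin d × Fin d)) (hT : T ≠ 0)
    (S : EuclideanSpace ℝ (Fin d × Fin d)) :
    ⟪T, fderiv ℝ (matFn d a n) T S⟫ =
      ((1 + ‖T‖ ^ a) ^ (-(1 + 1 / a)) +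
        ((n : ℝ) + ‖T‖ ^ (1 - 1 / (n : ℝ))) /
          ((n : ℝ) ^ 2 * (1 + ‖T‖ ^ (1 - 1 / (n : ℝ))) ^ 2)) * ⟪T, S⟫ := by
  have hr : 0 < ‖T‖ := norm_pos_iff.mpr hT
  have hn0 : (n : ℝ) ≠ 0 := by positivity
  have hu (p : ℝ) : 0 < ‖T‖ ^ p := Real.rpow_pos_of_pos hr p
  have hderiv (p : ℝ) : HasDerivAt (fun r : ℝ => 1 + r ^ p) (p * ‖T‖ ^ (p - 1)) ‖T‖ :=
    (Real.hasDerivAt_rpow_const (Or.inl hr.ne')).const_add 1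
  have hne (p : ℝ) : 1 + ‖T‖ ^ p ≠ 0 := (add_pos one_pos (hu p)).ne'
  have hmul (p : ℝ) : ‖T‖ ^ (p - 1) = ‖T‖ ^ p / ‖T‖ := Real.rpow_sub_one hr.ne' p
  obtain ⟨hF, hF'⟩ := inner_fderiv_radial hT
    ((hderiv a).rpow_const (p := -(1 / a)) (Or.inl (hne a))) S
  obtain ⟨hG, hG'⟩ := inner_fderiv_radial hT
    (((hderiv (1 - 1 / (n : ℝ))).const_mul (n : ℝ)).fun_inv (mul_ne_zero hn0 (hne _))) S
  have hsum : matFn d a n = (fun y => ((1 + ‖y‖ ^ a) ^ (-(1 / a))) • y) +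
      fun y => ((n : ℝ) * (1 + ‖y‖ ^ (1 - 1 / (n : ℝ))))⁻¹ • y := rfl
  rw [hsum, fderiv_add hF hG, add_apply, inner_add_right, hF', hG', ← add_mul]
  congr 2
  · have hs : (1 + ‖T‖ ^ a) ^ (-(1 / a)) =
        (1 + ‖T‖ ^ a) ^ (-(1 + 1 / a)) * (1 + ‖T‖ ^ a) := by
      rw [← Real.rpow_add_one (hne a)]
      congr 1
      ring
    rw [hs, hmul, show -(1 / a) - 1 = -(1 + 1 / a) by ring]
    field_simp
    ring
  · have h := hne (1 - 1 / (n : ℝ))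
    rw [hmul]
    generalize ‖T‖ ^ (1 - 1 / (n : ℝ)) = u at h ⊢
    field_simp
    ring
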